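/- For every natural number k and every formula φ: (1) if φ ∈ E_k^+, then PNF(φ) ∩ Σ_k^+ ≠ ∅; (2) if φ ∈ U_k^+, then PNF(φ) ∩ Π_k^+ ≠ ∅. -/

import Mathlib

namespace PrenexPaper

/-- A first-order language: function symbols and relation symbols with arities. -/
structure Lang where
  Func : Type
  farity : Func → ℕ
  Rel : Type
  rarity : Rel → ℕ

/-- First-order terms over a language `L` with variables from `V`. -/
inductive Term (L : Lang) (V : Type) : Type
  | var : V → Term L V
  | func : (f : L.Func) → (Fin (L.farity f) → Term L V) → Term L V

/-- First-order formulas built from atomic formulas (including ⊥) by ∧, ∨, →, ∀x, ∃x. -/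
inductive Fml (L : Lang) (V : Type) : Type
  | falsum : Fml L V
  | rel : (r : L.Rel) → (Fin (L.rarity r) → Term L V) → Fml L V
  | and : Fml L V → Fml L V → Fml L V
  | or : Fml L V → Fml L V → Fml L V
  | imp : Fml L V → Fml L V → Fml L V
  | all : V → Fml L V → Fml L V
  | ex : V → Fml L V → Fml L V

variable {L : Lang} {V : Type}

/-- Variables occurring in a term. -/
def Term.vars : Term L V → Set V
  | .var x => {x}
  | .func _ ts => ⋃ i, (ts i).vars

/-- Free variables of a formula. -/
def Fml.fv : Fml L V → Set V
  | .falsum => ∅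
  | .rel _ ts => ⋃ i, (ts i).vars
  | .and φ ψ => φ.fv ∪ ψ.fv
  | .or φ ψ => φ.fv ∪ ψ.fv
  | .imp φ ψ => φ.fv ∪ ψ.fv
  | .all x φ => φ.fv \ {x}
  | .ex x φ => φ.fv \ {x}

/-- All variables appearing in a formula (free or bound). -/
def Fml.vars : Fml L V → Set V
  | .falsum => ∅
  | .rel _ ts => ⋃ i, (ts i).vars
  | .and φ ψ => φ.vars ∪ ψ.vars
  | .or φ ψ => φ.vars ∪ ψ.vars
  | .imp φ ψ => φ.vars ∪ ψ.vars
  | .all x φ => insert x φ.vars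
  | .ex x φ => insert x φ.vars

/-- Number of quantifier occurrences. -/
def Fml.numQ : Fml L V → ℕ
  | .falsum => 0
  | .rel _ _ => 0
  | .and φ ψ => φ.numQ + ψ.numQ
  | .or φ ψ => φ.numQ + ψ.numQ
  | .imp φ ψ => φ.numQ + ψ.numQ
  | .all _ φ => φ.numQ + 1
  | .ex _ φ => φ.numQ + 1

/-- Number of occurrences of the binary connectives ∧, ∨, →. -/
def Fml.numConn : Fml L V → ℕ
  | .falsum => 0
  | .rel _ _ => 0
  | .and φ ψ => φ.numConn + ψ.numConn + 1
  | .or φ ψ => φ.numConn + ψ.numConn + 1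
  | .imp φ ψ => φ.numConn + ψ.numConn + 1
  | .all _ φ => φ.numConn
  | .ex _ φ => φ.numConn

/-- Quantifier-free formulas. -/
def Fml.qf : Fml L V → Prop
  | .falsum => True
  | .rel _ _ => True
  | .and φ ψ => φ.qf ∧ ψ.qf
  | .or φ ψ => φ.qf ∧ ψ.qf
  | .imp φ ψ => φ.qf ∧ ψ.qf
  | .all _ _ => False
  | .ex _ _ => False

/-! ### Alternation paths and the classes E, U, F, PF

An alternation path is represented as a `List Bool`, where `true` stands for `+`
and `false` stands for `−` (alternation is automatic from the construction below). -/

/-- `s^⊥`: switch + and − in an alternation path. -/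
def negPath (s : List Bool) : List Bool := s.map (fun b => !b)

/-- The set `Alt(φ)` of alternation paths of a formula.  The first symbol `i(s)` of a
path `s` is `s.head?` (`none` corresponding to `×` for the empty path). -/
def Fml.alt : Fml L V → Set (List Bool)
  | .falsum => {[]}
  | .rel _ _ => {[]}
  | .and φ ψ => φ.alt ∪ ψ.alt
  | .or φ ψ => φ.alt ∪ ψ.alt
  | .imp φ ψ => (negPath '' φ.alt) ∪ ψ.alt
  | .all _ φ => {s ∈ φ.alt | s.head? = some false} ∪
      (fun s => false :: s) '' {s ∈ φ.alt | s.head? ≠ some false}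
  | .ex _ φ => {s ∈ φ.alt | s.head? = some true} ∪
      (fun s => true :: s) '' {s ∈ φ.alt | s.head? ≠ some true}

/-- The degree `deg(φ) = max { l(s) | s ∈ Alt(φ) }`. -/
noncomputable def Fml.deg (φ : Fml L V) : ℕ := sSup (List.length '' φ.alt)

/-- The class `F_k` of formulas of degree exactly `k`. -/
def Fc (k : ℕ) : Set (Fml L V) := {φ | φ.deg = k}

/-- The cumulative class `F_k^+` of formulas of degree at most `k`. -/
def FcP (k : ℕ) : Set (Fml L V) := {φ | φ.deg ≤ k}

/-- The class `U_k`. -/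
def Uc : ℕ → Set (Fml L V)
  | 0 => Fc 0
  | (k+1) => {φ | φ ∈ Fc (k+1) ∧ ∀ s ∈ φ.alt, s.length = k+1 → s.head? = some false}

/-- The class `E_k`. -/
def Ec : ℕ → Set (Fml L V)
  | 0 => Fc 0
  | (k+1) => {φ | φ ∈ Fc (k+1) ∧ ∀ s ∈ φ.alt, s.length = k+1 → s.head? = some true}

/-- The class `PF_k = F_k \ (E_k ∪ U_k)`. -/
def PFc (k : ℕ) : Set (Fml L V) := Fc k \ (Ec k ∪ Uc k)

/-- The cumulative class `U_k^+ = U_k ∪ ⋃_{i<k} F_i`. -/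
def UcP (k : ℕ) : Set (Fml L V) := Uc k ∪ ⋃ i < k, Fc i

/-- The cumulative class `E_k^+ = E_k ∪ ⋃_{i<k} F_i`. -/
def EcP (k : ℕ) : Set (Fml L V) := Ec k ∪ ⋃ i < k, Fc i

/-! ### The prenex classes Σ_k and Π_k -/

/-- Formulas `∃x₁⋯∃xₙ φ` with `n ≥ 1` and `φ ∈ S`. -/
inductive ExBlock (S : Set (Fml L V)) : Fml L V → Prop
  | one {x : V} {φ : Fml L V} : φ ∈ S → ExBlock S (.ex x φ)
  | more {x : V} {φ : Fml L V} : ExBlock S φ → ExBlock S (.ex x φ)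

/-- Formulas `∀x₁⋯∀xₙ φ` with `n ≥ 1` and `φ ∈ S`. -/
inductive AllBlock (S : Set (Fml L V)) : Fml L V → Prop
  | one {x : V} {φ : Fml L V} : φ ∈ S → AllBlock S (.all x φ)
  | more {x : V} {φ : Fml L V} : AllBlock S φ → AllBlock S (.all x φ)

/-- The pair `(Σ_k, Π_k)`. -/
def SP : ℕ → Set (Fml L V) × Set (Fml L V)
  | 0 => ({φ | φ.qf}, {φ | φ.qf})
  | (k+1) => ({φ | ExBlock (SP k).2 φ}, {φ | AllBlock (SP k).1 φ})

/-- The class `Σ_k`. -/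
def SigmaC (k : ℕ) : Set (Fml L V) := (SP k).1

/-- The class `Π_k`. -/
def PiC (k : ℕ) : Set (Fml L V) := (SP k).2

/-- The cumulative class `Σ_k^+ = Σ_k ∪ ⋃_{i<k} (Σ_i ∪ Π_i)`. -/
def SigmaP (k : ℕ) : Set (Fml L V) := SigmaC k ∪ ⋃ i < k, (SigmaC i ∪ PiC i)

/-- The cumulative class `Π_k^+ = Π_k ∪ ⋃_{i<k} (Σ_i ∪ Π_i)`. -/
def PiP (k : ℕ) : Set (Fml L V) := PiC k ∪ ⋃ i < k, (SigmaC i ∪ PiC i)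

/-- A formula is in prenex normal form if it is in `Σ_k ∪ Π_k` for some `k`. -/
def Prenex (φ : Fml L V) : Prop := ∃ k, φ ∈ SigmaC k ∪ PiC k

/-! ### Prenex transformations -/

variable [DecidableEq V]

/-- Replace the variable `x` by `y` in a term. -/
def Term.rename (x y : V) : Term L V → Term L V
  | .var z => if z = x then .var y else .var z
  | .func f ts => .func f (fun i => (ts i).rename x y)

/-- Replace the free occurrences of the variable `x` by `y` in a formula. -/
def Fml.rename (x y : V) : Fml L V → Fml L V
  | .falsum => .falsum
  | .rel r ts => .rel r (fun i => (ts i).rename x y)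
  | .and φ ψ => .and (φ.rename x y) (ψ.rename x y)
  | .or φ ψ => .or (φ.rename x y) (ψ.rename x y)
  | .imp φ ψ => .imp (φ.rename x y) (ψ.rename x y)
  | .all z φ => if z = x then .all z φ else .all z (φ.rename x y)
  | .ex z φ => if z = x then .ex z φ else .ex z (φ.rename x y)

/-- `φ ⊳ ψ` : `ψ` is a prenex transformation of `φ` (the eight rows of the table,
rows 3–8 for both quantifiers). -/
inductive Step : Fml L V → Fml L V → Prop
  | r1 (x : V) (ξ δ : Fml L V) (h : x ∉ δ.fv) :
      Step (.imp (.ex x ξ) δ) (.all x (.imp ξ δ))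
  | r2 (x : V) (ξ δ : Fml L V) (h : x ∉ δ.fv) :
      Step (.imp (.all x ξ) δ) (.ex x (.imp ξ δ))
  | r3all (x : V) (ξ δ : Fml L V) (h : x ∉ δ.fv) :
      Step (.imp δ (.all x ξ)) (.all x (.imp δ ξ))
  | r3ex (x : V) (ξ δ : Fml L V) (h : x ∉ δ.fv) :
      Step (.imp δ (.ex x ξ)) (.ex x (.imp δ ξ))
  | r4all (x : V) (ξ δ : Fml L V) (h : x ∉ δ.fv) :
      Step (.and (.all x ξ) δ) (.all x (.and ξ δ))
  | r4ex (x : V) (ξ δ : Fml L V) (h : x ∉ δ.fv) :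
      Step (.and (.ex x ξ) δ) (.ex x (.and ξ δ))
  | r5all (x : V) (ξ δ : Fml L V) (h : x ∉ δ.fv) :
      Step (.and δ (.all x ξ)) (.all x (.and δ ξ))
  | r5ex (x : V) (ξ δ : Fml L V) (h : x ∉ δ.fv) :
      Step (.and δ (.ex x ξ)) (.ex x (.and δ ξ))
  | r6all (x : V) (ξ δ : Fml L V) (h : x ∉ δ.fv) :
      Step (.or (.all x ξ) δ) (.all x (.or ξ δ))
  | r6ex (x : V) (ξ δ : Fml L V) (h : x ∉ δ.fv) :
      Step (.or (.ex x ξ) δ) (.ex x (.or ξ δ))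
  | r7all (x : V) (ξ δ : Fml L V) (h : x ∉ δ.fv) :
      Step (.or δ (.all x ξ)) (.all x (.or δ ξ))
  | r7ex (x : V) (ξ δ : Fml L V) (h : x ∉ δ.fv) :
      Step (.or δ (.ex x ξ)) (.ex x (.or δ ξ))
  | r8all (x y : V) (ξ : Fml L V) (h : y ∉ ξ.vars) :
      Step (.all x ξ) (.all y (ξ.rename x y))
  | r8ex (x y : V) (ξ : Fml L V) (h : y ∉ ξ.vars) :
      Step (.ex x ξ) (.ex y (ξ.rename x y))

/-- `Repl R φ ψ` : `ψ` is obtained from `φ` by replacing one occurrence of a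
subformula `ξ` of `φ` with a formula `δ` such that `R ξ δ`. -/
inductive Repl (R : Fml L V → Fml L V → Prop) : Fml L V → Fml L V → Prop
  | base {φ ψ : Fml L V} : R φ ψ → Repl R φ ψ
  | andL {φ φ' ψ : Fml L V} : Repl R φ φ' → Repl R (.and φ ψ) (.and φ' ψ)
  | andR {φ ψ ψ' : Fml L V} : Repl R ψ ψ' → Repl R (.and φ ψ) (.and φ ψ')
  | orL {φ φ' ψ : Fml L V} : Repl R φ φ' → Repl R (.or φ ψ) (.or φ' ψ)
  | orR {φ ψ ψ' : Fml L V} : Repl R ψ ψ' → Repl R (.or φ ψ) (.or φ ψ')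
  | impL {φ φ' ψ : Fml L V} : Repl R φ φ' → Repl R (.imp φ ψ) (.imp φ' ψ)
  | impR {φ ψ ψ' : Fml L V} : Repl R ψ ψ' → Repl R (.imp φ ψ) (.imp φ ψ')
  | allC {x : V} {φ φ' : Fml L V} : Repl R φ φ' → Repl R (.all x φ) (.all x φ')
  | exC {x : V} {φ φ' : Fml L V} : Repl R φ φ' → Repl R (.ex x φ) (.ex x φ')

/-- `φ ⊳* ψ` : `ψ` is obtained from `φ` by finitely many prenex transformations,
each applied to one occurrence of a subformula. -/
def DTA : Fml L V → Fml L V → Prop := Relation.ReflTransGen (Repl Step)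

/-- `PNF(φ)` : the set of prenex normal forms reachable from `φ`. -/
def PNF (φ : Fml L V) : Set (Fml L V) := {ψ | DTA φ ψ ∧ Prenex ψ}

/-! ### Tarskian semantics -/

/-- A structure for the language `L` with domain `M`. -/
structure Struc (L : Lang) (M : Type) where
  funcI : (f : L.Func) → (Fin (L.farity f) → M) → M
  relI : (r : L.Rel) → (Fin (L.rarity r) → M) → Prop

/-- Evaluation of a term in a structure under a variable assignment. -/
def Term.eval {M : Type} (S : Struc L M) (v : V → M) : Term L V → M
  | .var x => v x
  | .func f ts => S.funcI f (fun i => (ts i).eval S v)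

/-- Tarskian satisfaction of a formula in a structure under a variable assignment. -/
def Sat {M : Type} (S : Struc L M) (v : V → M) : Fml L V → Prop
  | .falsum => False
  | .rel r ts => S.relI r (fun i => (ts i).eval S v)
  | .and φ ψ => Sat S v φ ∧ Sat S v ψ
  | .or φ ψ => Sat S v φ ∨ Sat S v ψ
  | .imp φ ψ => Sat S v φ → Sat S v ψ
  | .all x φ => ∀ m : M, Sat S (Function.update v x m) φ
  | .ex x φ => ∃ m : M, Sat S (Function.update v x m) φ

/-! ### Auxiliary material for the proof -/

set_option linter.unusedSectionVars false

/-- The quantifier `∃` (`true`) or `∀` (`false`). -/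
def Qu (b : Bool) (x : V) (φ : Fml L V) : Fml L V :=
  match b with
  | true => .ex x φ
  | false => .all x φ

/-- Binary connectives. -/
inductive Con : Type
  | and
  | or
  | imp

/-- Apply a binary connective. -/
def Con.app (c : Con) (φ ψ : Fml L V) : Fml L V :=
  match c with
  | .and => .and φ ψ
  | .or => .or φ ψ
  | .imp => .imp φ ψ

/-- Polarity of the left argument of a connective. -/
def Con.pol (c : Con) (b : Bool) : Bool :=
  match c with
  | .and => b
  | .or => b
  | .imp => !b

/-- An inductive version of the classes `Σ_k^+` (`true`) and `Π_k^+` (`false`). -/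
inductive Pr : Bool → ℕ → Fml L V → Prop
  | qf {b : Bool} {k : ℕ} {φ : Fml L V} : φ.qf → Pr b k φ
  | qt {b : Bool} {k : ℕ} {x : V} {φ : Fml L V} : Pr b (k+1) φ → Pr b (k+1) (Qu b x φ)
  | sw {b : Bool} {k : ℕ} {φ : Fml L V} : Pr (!b) k φ → Pr b (k+1) φ

theorem Pr.inv {b : Bool} {k : ℕ} {φ : Fml L V} (h : Pr b k φ) :
    φ.qf ∨ (∃ x ξ, φ = Qu b x ξ ∧ Pr b k ξ) ∨ (∃ j, k = j + 1 ∧ Pr (!b) j φ) := by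
  cases h with
  | qf h => exact Or.inl h
  | qt h => exact Or.inr (Or.inl ⟨_, _, rfl, h⟩)
  | sw h => exact Or.inr (Or.inr ⟨_, rfl, h⟩)

theorem rename_numQ (x y : V) (φ : Fml L V) : (φ.rename x y).numQ = φ.numQ := by
  induction φ with
  | falsum => rfl
  | rel r ts => rfl
  | and φ ψ h1 h2 => simp [Fml.rename, Fml.numQ, h1, h2]
  | or φ ψ h1 h2 => simp [Fml.rename, Fml.numQ, h1, h2]
  | imp φ ψ h1 h2 => simp [Fml.rename, Fml.numQ, h1, h2]
  | all z φ h => by_cases hz : z = x <;> simp [Fml.rename, Fml.numQ, hz, h]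
  | ex z φ h => by_cases hz : z = x <;> simp [Fml.rename, Fml.numQ, hz, h]

theorem rename_qf (x y : V) (φ : Fml L V) (hq : φ.qf) : (φ.rename x y).qf := by
  induction φ with
  | falsum => trivial
  | rel r ts => trivial
  | and φ ψ h1 h2 => exact ⟨h1 hq.1, h2 hq.2⟩
  | or φ ψ h1 h2 => exact ⟨h1 hq.1, h2 hq.2⟩
  | imp φ ψ h1 h2 => exact ⟨h1 hq.1, h2 hq.2⟩
  | all z φ h => exact hq.elim
  | ex z φ h => exact hq.elim

theorem rename_Qu (x y : V) (b : Bool) (z : V) (φ : Fml L V) :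
    (Qu b z φ).rename x y = Qu b z φ ∨ (Qu b z φ).rename x y = Qu b z (φ.rename x y) := by
  cases b <;> by_cases hz : z = x <;> simp [Qu, Fml.rename, hz]

theorem Pr.rename {b : Bool} {k : ℕ} {φ : Fml L V} (h : Pr b k φ) (x y : V) :
    Pr b k (φ.rename x y) := by
  induction h with
  | qf h => exact .qf (rename_qf x y _ h)
  | @qt b k z φ h ih =>
    rcases rename_Qu x y b z φ with h' | h' <;> rw [h']
    · exact .qt h
    · exact .qt ih
  | sw h ih => exact .sw ih

theorem Term.vars_finite (t : Term L V) : t.vars.Finite := by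
  induction t with
  | var x => exact Set.finite_singleton x
  | func f ts ih => exact Set.finite_iUnion ih

theorem Fml.vars_finite (φ : Fml L V) : φ.vars.Finite := by
  induction φ with
  | falsum => exact Set.finite_empty
  | rel r ts => exact Set.finite_iUnion fun i => (ts i).vars_finite
  | and φ ψ h1 h2 => exact h1.union h2
  | or φ ψ h1 h2 => exact h1.union h2
  | imp φ ψ h1 h2 => exact h1.union h2
  | all z φ h => exact h.insert z
  | ex z φ h => exact h.insert z

theorem Fml.fv_finite (φ : Fml L V) : φ.fv.Finite := by
  induction φ with
  | falsum => exact Set.finite_empty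
  | rel r ts => exact Set.finite_iUnion fun i => (ts i).vars_finite
  | and φ ψ h1 h2 => exact h1.union h2
  | or φ ψ h1 h2 => exact h1.union h2
  | imp φ ψ h1 h2 => exact h1.union h2
  | all z φ h => exact h.sdiff
  | ex z φ h => exact h.sdiff

theorem DTA.trans {φ ψ χ : Fml L V} (h1 : DTA φ ψ) (h2 : DTA ψ χ) : DTA φ χ :=
  Relation.ReflTransGen.trans h1 h2

theorem DTA.step {φ ψ : Fml L V} (h : Step φ ψ) : DTA φ ψ :=
  Relation.ReflTransGen.single (Repl.base h)

theorem DTA.appL (c : Con) {φ φ' : Fml L V} (ψ : Fml L V) (h : DTA φ φ') :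
    DTA (c.app φ ψ) (c.app φ' ψ) := by
  refine Relation.ReflTransGen.lift (fun φ => c.app φ ψ) (fun a b hab => ?_) _ _ h
  cases c
  · exact .andL hab
  · exact .orL hab
  · exact .impL hab

theorem DTA.appR (c : Con) {ψ ψ' : Fml L V} (φ : Fml L V) (h : DTA ψ ψ') :
    DTA (c.app φ ψ) (c.app φ ψ') := by
  refine Relation.ReflTransGen.lift (fun ψ => c.app φ ψ) (fun a b hab => ?_) _ _ h
  cases c
  · exact .andR hab
  · exact .orR hab
  · exact .impR hab

theorem DTA.qu (b : Bool) (x : V) {φ φ' : Fml L V} (h : DTA φ φ') :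
    DTA (Qu b x φ) (Qu b x φ') := by
  refine Relation.ReflTransGen.lift (fun φ => Qu b x φ) (fun a c hab => ?_) _ _ h
  cases b
  · exact .allC hab
  · exact .exC hab

theorem DTA.ren (b : Bool) (x y : V) (φ : Fml L V) (h : y ∉ φ.vars) :
    DTA (Qu b x φ) (Qu b y (φ.rename x y)) := by
  cases b
  · exact .step (.r8all x y φ h)
  · exact .step (.r8ex x y φ h)

theorem DTA.pullL (c : Con) (b : Bool) (x : V) (ξ δ : Fml L V) (h : x ∉ δ.fv) :
    DTA (c.app (Qu (c.pol b) x ξ) δ) (Qu b x (c.app ξ δ)) := by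
  cases c <;> cases b
  · exact .step (.r4all x ξ δ h)
  · exact .step (.r4ex x ξ δ h)
  · exact .step (.r6all x ξ δ h)
  · exact .step (.r6ex x ξ δ h)
  · exact .step (.r1 x ξ δ h)
  · exact .step (.r2 x ξ δ h)

theorem DTA.pullR (c : Con) (b : Bool) (x : V) (ξ δ : Fml L V) (h : x ∉ δ.fv) :
    DTA (c.app δ (Qu b x ξ)) (Qu b x (c.app δ ξ)) := by
  cases c <;> cases b
  · exact .step (.r5all x ξ δ h)
  · exact .step (.r5ex x ξ δ h)
  · exact .step (.r7all x ξ δ h)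
  · exact .step (.r7ex x ξ δ h)
  · exact .step (.r3all x ξ δ h)
  · exact .step (.r3ex x ξ δ h)

theorem fresh [Infinite V] (φ ψ : Fml L V) : ∃ y : V, y ∉ φ.vars ∧ y ∉ ψ.fv := by
  obtain ⟨y, hy⟩ := (φ.vars_finite.union ψ.fv_finite).exists_notMem
  exact ⟨y, fun h => hy (Or.inl h), fun h => hy (Or.inr h)⟩

theorem numQ_Qu (b : Bool) (x : V) (φ : Fml L V) : (Qu b x φ).numQ = φ.numQ + 1 := by
  cases b <;> rfl

theorem Pr.inv_succ {b : Bool} {k : ℕ} {φ : Fml L V} (h : Pr b (k+1) φ) :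
    (∃ x ξ, φ = Qu b x ξ ∧ Pr b (k+1) ξ) ∨ Pr (!b) k φ := by
  rcases h.inv with h | h | ⟨j, hj, h⟩
  · exact Or.inr (.qf h)
  · exact Or.inl h
  · obtain rfl : k = j := by omega
    exact Or.inr h

theorem Pr.inv_zero {b : Bool} {φ : Fml L V} (h : Pr b 0 φ) : φ.qf := by
  cases h with
  | qf h => exact h

theorem Con.pol_not (c : Con) (b : Bool) : c.pol (!b) = !(c.pol b) := by
  cases c <;> rfl

/-- Combining two prenex formulas by a connective. -/
theorem combine [Infinite V] (c : Con) (k : ℕ) : ∀ (b : Bool) (φ ψ : Fml L V),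
    Pr (c.pol b) k φ → Pr b k ψ → ∃ χ, DTA (c.app φ ψ) χ ∧ Pr b k χ := by
  induction k with
  | zero =>
    intro b φ ψ h1 h2
    refine ⟨_, Relation.ReflTransGen.refl, .qf ?_⟩
    cases c <;> exact ⟨h1.inv_zero, h2.inv_zero⟩
  | succ k ihk =>
    intro b φ ψ
    induction hn : φ.numQ + ψ.numQ using Nat.strong_induction_on generalizing φ ψ with
    | _ n ih =>
      intro h1 h2
      rcases h1.inv_succ with ⟨x, ξ, rfl, hξ⟩ | h1'
      · obtain ⟨y, hy1, hy2⟩ := fresh ξ ψ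
        rw [numQ_Qu] at hn
        obtain ⟨χ, hχ, hp⟩ := ih ((ξ.rename x y).numQ + ψ.numQ)
          (by rw [rename_numQ]; omega) _ _ rfl (hξ.rename x y) h2
        exact ⟨Qu b y χ, ((DTA.appL c ψ (DTA.ren _ x y ξ hy1)).trans
          (DTA.pullL c b y _ ψ hy2)).trans (DTA.qu b y hχ), .qt hp⟩
      · rcases h2.inv_succ with ⟨x, ξ, rfl, hξ⟩ | h2'
        · obtain ⟨y, hy1, hy2⟩ := fresh ξ φ
          rw [numQ_Qu] at hn
          obtain ⟨χ, hχ, hp⟩ := ih (φ.numQ + (ξ.rename x y).numQ)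
            (by rw [rename_numQ]; omega) _ _ rfl h1 (hξ.rename x y)
          exact ⟨Qu b y χ, ((DTA.appR c φ (DTA.ren _ x y ξ hy1)).trans
            (DTA.pullR c b y _ φ hy2)).trans (DTA.qu b y hχ), .qt hp⟩
        · obtain ⟨χ, hχ, hp⟩ := ihk (!b) φ ψ (by rw [Con.pol_not]; exact h1') h2'
          exact ⟨χ, hχ, .sw hp⟩

/-- Path version of `E_k^+` (`true`) and `U_k^+` (`false`). -/
def PP (b : Bool) (k : ℕ) (φ : Fml L V) : Prop :=
  ∀ s ∈ φ.alt, s.length ≤ k ∧ (s.length = k → 0 < k → s.head? = some b)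

theorem alt_nonempty (φ : Fml L V) : φ.alt.Nonempty := by
  induction φ with
  | falsum => exact ⟨_, rfl⟩
  | rel r ts => exact ⟨_, rfl⟩
  | and φ ψ h1 h2 => exact h1.inl
  | or φ ψ h1 h2 => exact h1.inl
  | imp φ ψ h1 h2 => exact h2.inr
  | all z φ h =>
    obtain ⟨s, hs⟩ := h
    by_cases h : s.head? = some false
    · exact ⟨s, Or.inl ⟨hs, h⟩⟩
    · exact ⟨_, Or.inr ⟨s, ⟨hs, h⟩, rfl⟩⟩
  | ex z φ h =>
    obtain ⟨s, hs⟩ := h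
    by_cases h : s.head? = some true
    · exact ⟨s, Or.inl ⟨hs, h⟩⟩
    · exact ⟨_, Or.inr ⟨s, ⟨hs, h⟩, rfl⟩⟩

theorem alt_finite (φ : Fml L V) : φ.alt.Finite := by
  induction φ with
  | falsum => exact Set.finite_singleton _
  | rel r ts => exact Set.finite_singleton _
  | and φ ψ h1 h2 => exact h1.union h2
  | or φ ψ h1 h2 => exact h1.union h2
  | imp φ ψ h1 h2 => exact (h1.image _).union h2
  | all z φ h =>
    exact (h.subset (Set.sep_subset _ _)).union
      ((h.subset (Set.sep_subset _ _)).image _)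
  | ex z φ h =>
    exact (h.subset (Set.sep_subset _ _)).union
      ((h.subset (Set.sep_subset _ _)).image _)

theorem alt_Qu (b : Bool) (x : V) (φ : Fml L V) : (Qu b x φ).alt =
    {s ∈ φ.alt | s.head? = some b} ∪ (fun s => b :: s) '' {s ∈ φ.alt | s.head? ≠ some b} := by
  cases b <;> rfl

theorem alt_Qu_head {b : Bool} {x : V} {φ : Fml L V} {s : List Bool}
    (h : s ∈ (Qu b x φ).alt) : s.head? = some b := by
  rw [alt_Qu] at h
  rcases h with h | ⟨t, -, rfl⟩
  · exact h.2
  · rfl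

/-- A quantified formula lies in the class of its own sign. -/
theorem main_qu (b : Bool) (x : V) (φ : Fml L V)
    (ih : ∀ b k, PP b k φ → ∃ ψ, DTA φ ψ ∧ Pr b k ψ) :
    ∀ k, PP b k (Qu b x φ) → ∃ ψ, DTA (Qu b x φ) ψ ∧ Pr b k ψ := by
  intro k h
  obtain ⟨s, hs⟩ := alt_nonempty (Qu b x φ)
  have hk : 0 < k := by
    have h1 := alt_Qu_head hs
    have h2 := (h s hs).1
    cases s with
    | nil => simp at h1
    | cons a s => simp at h2; omega
  obtain ⟨j, rfl⟩ : ∃ j, k = j + 1 := ⟨k - 1, by omega⟩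
  obtain ⟨ψ, h1, h2⟩ := ih b (j+1) (by
    intro t ht
    by_cases hb : t.head? = some b
    · refine ⟨(h t ?_).1, fun _ _ => hb⟩
      rw [alt_Qu]; exact Or.inl ⟨ht, hb⟩
    · have := (h (b :: t) (by rw [alt_Qu]; exact Or.inr ⟨t, ⟨ht, hb⟩, rfl⟩)).1
      simp at this
      exact ⟨by omega, fun _ => by omega⟩)
  exact ⟨_, DTA.qu b x h1, .qt h2⟩

theorem main_qu' (b : Bool) (x : V) (φ : Fml L V)
    (ih : ∀ b k, PP b k φ → ∃ ψ, DTA φ ψ ∧ Pr b k ψ) :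
    ∀ b' k, PP b' k (Qu b x φ) → ∃ ψ, DTA (Qu b x φ) ψ ∧ Pr b' k ψ := by
  intro b' k h
  by_cases hb : b' = b
  · subst hb; exact main_qu b' x φ ih k h
  · have hlt : ∀ s ∈ (Qu b x φ).alt, s.length < k ∧ s.head? = some b := by
      intro s hs
      have h1 := alt_Qu_head hs
      refine ⟨lt_of_le_of_ne (h s hs).1 fun he => ?_, h1⟩
      have hk : 0 < k := by
        rw [← he]
        cases s with
        | nil => simp at h1
        | cons a s => simp
      have := (h s hs).2 he hk
      rw [h1] at this
      exact hb (Option.some.inj this).symm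
    obtain ⟨s, hs⟩ := alt_nonempty (Qu b x φ)
    have := (hlt s hs).1
    obtain ⟨j, rfl⟩ : ∃ j, k = j + 1 := ⟨k - 1, by omega⟩
    obtain ⟨ψ, h1, h2⟩ := main_qu b x φ ih j
      (fun t ht => ⟨by have := (hlt t ht).1; omega, fun _ _ => (hlt t ht).2⟩)
    refine ⟨ψ, h1, .sw ?_⟩
    have : (!b') = b := by cases b <;> cases b' <;> simp_all
    rw [this]; exact h2

theorem main_con [Infinite V] (c : Con) (φ ψ : Fml L V)
    (ih1 : ∀ b k, PP b k φ → ∃ ψ, DTA φ ψ ∧ Pr b k ψ)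
    (ih2 : ∀ b k, PP b k ψ → ∃ χ, DTA ψ χ ∧ Pr b k χ) :
    ∀ b k, PP b k (c.app φ ψ) → ∃ χ, DTA (c.app φ ψ) χ ∧ Pr b k χ := by
  intro b k h
  have hφ : PP (c.pol b) k φ := by
    intro s hs
    cases c with
    | and => exact h s (Or.inl hs)
    | or => exact h s (Or.inl hs)
    | imp =>
      have := h (negPath s) (Or.inl ⟨s, hs, rfl⟩)
      simp only [negPath, List.length_map, List.head?_map] at this
      refine ⟨this.1, fun a1 a2 => ?_⟩
      have h3 := this.2 a1 a2
      cases hh : s.head? with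
      | none => simp [hh] at h3
      | some d => cases d <;> cases b <;> simp_all [Con.pol]
  have hψ : PP b k ψ := by
    intro s hs
    cases c <;> exact h s (Or.inr hs)
  obtain ⟨φ', h1, p1⟩ := ih1 _ _ hφ
  obtain ⟨ψ', h2, p2⟩ := ih2 _ _ hψ
  obtain ⟨χ, h3, p3⟩ := combine c k b φ' ψ' p1 p2
  exact ⟨χ, ((DTA.appL c ψ h1).trans (DTA.appR c φ' h2)).trans h3, p3⟩

theorem main [Infinite V] (φ : Fml L V) :
    ∀ b k, PP b k φ → ∃ ψ, DTA φ ψ ∧ Pr b k ψ := by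
  induction φ with
  | falsum => exact fun b k _ => ⟨_, Relation.ReflTransGen.refl, .qf trivial⟩
  | rel r ts => exact fun b k _ => ⟨_, Relation.ReflTransGen.refl, .qf trivial⟩
  | and φ ψ h1 h2 => exact main_con .and φ ψ h1 h2
  | or φ ψ h1 h2 => exact main_con .or φ ψ h1 h2
  | imp φ ψ h1 h2 => exact main_con .imp φ ψ h1 h2
  | all z φ h => exact main_qu' false z φ h
  | ex z φ h => exact main_qu' true z φ h

/-- The class `Σ_k` (`true`) or `Π_k` (`false`). -/
def Cl (b : Bool) (k : ℕ) : Set (Fml L V) :=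
  match b with
  | true => SigmaC k
  | false => PiC k

theorem Cl_zero {b : Bool} {φ : Fml L V} : φ ∈ Cl b 0 ↔ φ.qf := by
  cases b <;> exact Iff.rfl

theorem Cl_one {b : Bool} {k : ℕ} {x : V} {φ : Fml L V} (h : φ ∈ Cl (!b) k) :
    Qu b x φ ∈ Cl b (k+1) := by
  cases b
  · exact AllBlock.one h
  · exact ExBlock.one h

theorem Cl_more {b : Bool} {k : ℕ} {x : V} {φ : Fml L V} (h : φ ∈ Cl b (k+1)) :
    Qu b x φ ∈ Cl b (k+1) := by
  cases b
  · exact AllBlock.more h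
  · exact ExBlock.more h

theorem Pr.cl {b : Bool} {k : ℕ} {φ : Fml L V} (h : Pr b k φ) :
    φ ∈ Cl b k ∨ ∃ i < k, ∃ d, φ ∈ Cl d i := by
  induction h with
  | @qf b k φ h =>
    rcases Nat.eq_zero_or_pos k with rfl | hk
    · exact Or.inl (Cl_zero.2 h)
    · exact Or.inr ⟨0, hk, b, Cl_zero.2 h⟩
  | @qt b k x φ _ ih =>
    rcases ih with h | ⟨i, hi, d, h⟩
    · exact Or.inl (Cl_more h)
    · by_cases hd : d = b
      · subst hd
        cases i with
        | zero =>
          have h' : Qu d x φ ∈ Cl d 1 := Cl_one (Cl_zero.2 (Cl_zero.1 h))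
          cases k with
          | zero => exact Or.inl h'
          | succ k => exact Or.inr ⟨1, by omega, d, h'⟩
        | succ i => exact Or.inr ⟨i + 1, hi, d, Cl_more h⟩
      · obtain rfl : d = !b := by cases d <;> cases b <;> simp_all
        have h' : Qu b x φ ∈ Cl b (i+1) := Cl_one h
        rcases Nat.lt_or_ge (i+1) (k+1) with h1 | h1
        · exact Or.inr ⟨_, h1, b, h'⟩
        · obtain rfl : i = k := by omega
          exact Or.inl h'
  | @sw b k φ _ ih =>
    rcases ih with h | ⟨i, hi, d, h⟩
    · exact Or.inr ⟨k, by omega, _, h⟩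
    · exact Or.inr ⟨i, by omega, d, h⟩

theorem Cl_sub {d : Bool} {i : ℕ} {φ : Fml L V} (h : φ ∈ Cl d i) :
    φ ∈ SigmaC i ∪ PiC i := by
  cases d
  · exact Or.inr h
  · exact Or.inl h

theorem Pr.prenex {b : Bool} {k : ℕ} {φ : Fml L V} (h : Pr b k φ) : Prenex φ := by
  rcases h.cl with h | ⟨i, _, d, h⟩
  · exact ⟨k, Cl_sub h⟩
  · exact ⟨i, Cl_sub h⟩

theorem Pr.sigmaP {k : ℕ} {φ : Fml L V} (h : Pr true k φ) : φ ∈ SigmaP k := by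
  rcases h.cl with h | ⟨i, hi, d, h⟩
  · exact Or.inl h
  · exact Or.inr (Set.mem_iUnion₂.2 ⟨i, hi, Cl_sub h⟩)

theorem Pr.piP {k : ℕ} {φ : Fml L V} (h : Pr false k φ) : φ ∈ PiP k := by
  rcases h.cl with h | ⟨i, hi, d, h⟩
  · exact Or.inl h
  · exact Or.inr (Set.mem_iUnion₂.2 ⟨i, hi, Cl_sub h⟩)

theorem length_le_deg {φ : Fml L V} {s : List Bool} (h : s ∈ φ.alt) : s.length ≤ φ.deg :=
  le_csSup ((alt_finite φ).image _).bddAbove ⟨s, h, rfl⟩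

theorem PP_of_lt {b : Bool} {k : ℕ} {φ : Fml L V} (h : φ ∈ ⋃ i < k, Fc (L := L) (V := V) i) :
    PP b k φ := by
  obtain ⟨i, hi, h⟩ := Set.mem_iUnion₂.1 h
  intro s hs
  have h1 := length_le_deg hs
  have h2 : φ.deg = i := h
  exact ⟨by omega, fun _ => by omega⟩

theorem PP_of_EcP {k : ℕ} {φ : Fml L V} (h : φ ∈ EcP k) : PP true k φ := by
  rcases h with h | h
  · cases k with
    | zero =>
      intro s hs
      have h2 : φ.deg = 0 := h
      exact ⟨h2 ▸ length_le_deg hs, fun _ => by omega⟩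
    | succ k =>
      intro s hs
      have h2 : φ.deg = k + 1 := h.1
      exact ⟨h2 ▸ length_le_deg hs, fun he _ => h.2 s hs he⟩
  · exact PP_of_lt h

theorem PP_of_UcP {k : ℕ} {φ : Fml L V} (h : φ ∈ UcP k) : PP false k φ := by
  rcases h with h | h
  · cases k with
    | zero =>
      intro s hs
      have h2 : φ.deg = 0 := h
      exact ⟨h2 ▸ length_le_deg hs, fun _ => by omega⟩
    | succ k =>
      intro s hs
      have h2 : φ.deg = k + 1 := h.1
      exact ⟨h2 ▸ length_le_deg hs, fun he _ => h.2 s hs he⟩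
  · exact PP_of_lt h

/-- (1) if φ ∈ E_k^+, then PNF(φ) ∩ Σ_k^+ ≠ ∅;
(2) if φ ∈ U_k^+, then PNF(φ) ∩ Π_k^+ ≠ ∅. -/
theorem stmt16 {L : Lang} {V : Type} [DecidableEq V] [Infinite V] (k : ℕ) (φ : Fml L V) :
    (φ ∈ EcP k → PNF φ ∩ SigmaP k ≠ ∅) ∧
    (φ ∈ UcP k → PNF φ ∩ PiP k ≠ ∅) := by
  constructor
  · intro h
    obtain ⟨ψ, h1, h2⟩ := main φ true k (PP_of_EcP h)
    exact Set.nonempty_iff_ne_empty.1 ⟨ψ, ⟨h1, h2.prenex⟩, h2.sigmaP⟩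
  · intro h
    obtain ⟨ψ, h1, h2⟩ := main φ false k (PP_of_UcP h)
    exact Set.nonempty_iff_ne_empty.1 ⟨ψ, ⟨h1, h2.prenex⟩, h2.piP⟩

end PrenexPaper
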